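/- Let n ≥ 2 and let I be a permutation of {1,…,n}. Under the identification t^{(k)}_a = 1/x^{(k)}_a, w_i = 1/u_i, μ_j/μ_{j+1} = ħ z_j, the normalized weight function W̃_I = W_I/E evaluated at x^{(k)}_j = u_{I_j} (i.e. t^{(k)}_j = 1/u_{I_j} and w_i = 1/u_i) equals (−1)^{n(n−1)/2} sgn(I) · Θ(N_I^+), where Θ(N_I^+) = ∏_{1≤j<k≤n, I_k<I_j} ϑ(u_{I_k}/u_{I_j}) · ∏_{1≤j<k≤n, I_k>I_j} ϑ(ħ^{−1} u_{I_j}/u_{I_k}) and sgn(I) is the sign of the permutation I; all parameters are generic so that every theta denominator appearing is nonzero. -/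

import Mathlib

noncomputable section
open scoped BigOperators

/-- `φ(x) = ∏_{i=0}^∞ (1 − x qⁱ)`. -/
def phiP (q x : ℂ) : ℂ := ∏' i : ℕ, (1 - x * q ^ i)

/-- The odd Jacobi theta function `ϑ(x) = (x^{1/2} − x^{−1/2}) φ(qx) φ(q/x)`,
expressed in terms of the chosen square root `y = x^{1/2}` of `x = y²`. -/
def thetaH (q y : ℂ) : ℂ := (y - y⁻¹) * phiP q (q * y ^ 2) * phiP q (q / y ^ 2)
/-- The (0-based) value `I_{k+1} - 1` of a permutation `I` of `{1,…,n}` at the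
(0-based) position `k`; junk value `0` if `k ≥ n`. -/
def pval (n : ℕ) (I : Equiv.Perm (Fin n)) (k : ℕ) : ℕ :=
  if h : k < n then ((I ⟨k, h⟩ : Fin n) : ℕ) else 0

/-- The `a`-th smallest (0-based position `a`) element of `{I_1,…,I_k}`, with all
values recorded 0-based: this is `i^{(k)}_{a+1} - 1` in the notation of the paper. -/
def ordIdx (n : ℕ) (I : Equiv.Perm (Fin n)) (k a : ℕ) : ℕ :=
  (((Finset.range k).image (pval n I)).sort (· ≤ ·)).getD a 0

/-- `j(I,k,a)`: the 0-based position `j` with `I_j = i^{(k)}_a`. -/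
def jIdx (n : ℕ) (I : Equiv.Perm (Fin n)) (k a : ℕ) : ℕ :=
  if h : ordIdx n I k a < n then ((I.symm ⟨ordIdx n I k a, h⟩ : Fin n) : ℕ) else 0

/-- The set of pairs `(j,k)` of 0-based indices with `0 ≤ j < k ≤ n-1`. -/
def pairsN (n : ℕ) : Finset (ℕ × ℕ) :=
  (Finset.range n ×ˢ Finset.range n).filter (fun p => p.1 < p.2)

/-- The order `I ≺ J`:  `i^{(k)}_m ≤ j^{(k)}_m` for all `1 ≤ k ≤ n-1`, `1 ≤ m ≤ k`. -/
def prec (n : ℕ) (I J : Equiv.Perm (Fin n)) : Prop :=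
  ∀ k, 1 ≤ k → k ≤ n - 1 → ∀ m, m < k → ordIdx n I k m ≤ ordIdx n J k m
/-- The factor `ψ_{I,k,a,c}(x)` of the elliptic weight function, expressed in terms of
the chosen square root `y` of the argument `x`.  Here `k` is the 1-based level
(`1 ≤ k ≤ n-1`) and `a, c` are 0-based positions; `sμ j` is the chosen square root of
`μ_{j+1}`, `sh` that of `ħ`. -/
def psiF (n : ℕ) (I : Equiv.Perm (Fin n)) (q sh : ℂ) (sμ : ℕ → ℂ) (k a c : ℕ) (y : ℂ) : ℂ :=
  if ordIdx n I (k + 1) c < ordIdx n I k a then thetaH q y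
  else if ordIdx n I (k + 1) c = ordIdx n I k a then
    thetaH q (y * (if pval n I k < ordIdx n I k a then sh⁻¹ else 1) *
        sμ (jIdx n I k a) / sμ k) /
      thetaH q ((if pval n I k < ordIdx n I k a then sh⁻¹ else 1) *
        sμ (jIdx n I k a) / sμ k)
  else thetaH q (y / sh)

/-- The chosen square root of the variable `t^{(k)}_{a+1}` (1-based level `1 ≤ k ≤ n`,
0-based position `a`), with the convention `t^{(n)}_j = w_j`. -/
def tvF (n : ℕ) (sw : ℕ → ℂ) (st : ℕ → ℕ → ℂ) (k a : ℕ) : ℂ :=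
  if k = n then sw a else st k a

/-- The function `U_I(t,w,ħ,μ)`, in terms of the chosen square roots of all parameters. -/
def UF (n : ℕ) (I : Equiv.Perm (Fin n)) (q sh : ℂ) (sμ sw : ℕ → ℂ) (st : ℕ → ℕ → ℂ) : ℂ :=
  ∏ k ∈ Finset.Icc 1 (n - 1),
    ((∏ a ∈ Finset.range k, ∏ c ∈ Finset.range (k + 1),
        psiF n I q sh sμ k a c (tvF n sw st (k + 1) c / tvF n sw st k a)) *
      ∏ a ∈ Finset.range k, ∏ b ∈ Finset.Ioo a k,
        thetaH q (sh * tvF n sw st k b / tvF n sw st k a) /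
          thetaH q (tvF n sw st k b / tvF n sw st k a))

/-- `E(t,ħ) = ∏_{k=1}^{n-1} ∏_{a,b=1}^{k} ϑ(ħ t^{(k)}_b/t^{(k)}_a)`. -/
def EF (n : ℕ) (q sh : ℂ) (sw : ℕ → ℂ) (st : ℕ → ℕ → ℂ) : ℂ :=
  ∏ k ∈ Finset.Icc 1 (n - 1), ∏ a ∈ Finset.range k, ∏ b ∈ Finset.range k,
    thetaH q (sh * tvF n sw st k b / tvF n sw st k a)

/-- The action on the variables `t^{(k)}_a` of a tuple `π` of permutations, one for each
level `k`: the `k`-th permutation permutes `t^{(k)}_1, …, t^{(k)}_k`. -/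
def permSt (n : ℕ) (π : (k : Fin n) → Equiv.Perm (Fin (k : ℕ))) (st : ℕ → ℕ → ℂ) :
    ℕ → ℕ → ℂ := fun k a =>
  if hk : k < n then (if ha : a < k then st k ((π ⟨k, hk⟩) ⟨a, ha⟩ : Fin k) else st k a)
  else st k a

/-- The elliptic weight function
`W_I = ϑ(ħ⁻¹)^{n(n-1)/2} Sym_{t^{(1)}} ⋯ Sym_{t^{(n-1)}} U_I`. -/
def WF (n : ℕ) (I : Equiv.Perm (Fin n)) (q sh : ℂ) (sμ sw : ℕ → ℂ) (st : ℕ → ℕ → ℂ) : ℂ :=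
  thetaH q sh⁻¹ ^ (n * (n - 1) / 2) *
    ∑ π : (k : Fin n) → Equiv.Perm (Fin (k : ℕ)), UF n I q sh sμ sw (permSt n π st)

/-! ### Helper lemmas -/

theorem thetaH_inv (q y : ℂ) : thetaH q y⁻¹ = - thetaH q y := by
  unfold thetaH
  have h1 : q * y⁻¹ ^ 2 = q / y ^ 2 := by rw [inv_pow]; rfl
  have h2 : q / y⁻¹ ^ 2 = q * y ^ 2 := by rw [inv_pow, div_inv_eq_mul]
  rw [h1, h2, inv_inv]; ring

theorem thetaH_one (q : ℂ) : thetaH q 1 = 0 := by simp [thetaH]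

theorem thetaH_zero (q : ℂ) : thetaH q 0 = 0 := by simp [thetaH]

theorem pval_lt (n : ℕ) (I : Equiv.Perm (Fin n)) (k : ℕ) (hk : k < n) : pval n I k < n := by
  simp [pval, hk]

theorem pval_inj (n : ℕ) (I : Equiv.Perm (Fin n)) {j k : ℕ} (hj : j < n) (hk : k < n)
    (h : pval n I j = pval n I k) : j = k := by
  simp only [pval, hj, hk, dif_pos] at h
  have := I.injective (Fin.ext h)
  simpa using this

theorem pval_injOn (n : ℕ) (I : Equiv.Perm (Fin n)) {k : ℕ} (hk : k ≤ n) :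
    Set.InjOn (pval n I) (Finset.range k : Set ℕ) := by
  intro a ha b hb h
  simp only [Finset.coe_range, Set.mem_Iio] at ha hb
  exact pval_inj n I (by omega) (by omega) h

theorem card_pset (n : ℕ) (I : Equiv.Perm (Fin n)) {k : ℕ} (hk : k ≤ n) :
    ((Finset.range k).image (pval n I)).card = k := by
  rw [Finset.card_image_of_injOn (pval_injOn n I hk), Finset.card_range]

theorem ordIdx_eq (n : ℕ) (I : Equiv.Perm (Fin n)) {k a : ℕ} (hk : k ≤ n) (ha : a < k) :
    ordIdx n I k a =
      ((Finset.range k).image (pval n I)).orderEmbOfFin (card_pset n I hk) ⟨a, ha⟩ := by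
  rw [Finset.orderEmbOfFin_apply]
  unfold ordIdx
  rw [List.getD_eq_getElem]
  rfl

theorem ordIdx_lt_iff (n : ℕ) (I : Equiv.Perm (Fin n)) {k a b : ℕ} (hk : k ≤ n) (ha : a < k)
    (hb : b < k) : ordIdx n I k a < ordIdx n I k b ↔ a < b := by
  rw [ordIdx_eq n I hk ha, ordIdx_eq n I hk hb]
  simp

theorem ordIdx_injOn (n : ℕ) (I : Equiv.Perm (Fin n)) {k : ℕ} (hk : k ≤ n) :
    Set.InjOn (ordIdx n I k) (Finset.range k : Set ℕ) := by
  intro a ha b hb h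
  simp only [Finset.coe_range, Set.mem_Iio] at ha hb
  have h1 := ordIdx_lt_iff n I hk ha hb
  have h2 := ordIdx_lt_iff n I hk hb ha
  omega

theorem image_ordIdx (n : ℕ) (I : Equiv.Perm (Fin n)) {k : ℕ} (hk : k ≤ n) :
    (Finset.range k).image (ordIdx n I k) = (Finset.range k).image (pval n I) := by
  apply Finset.eq_of_subset_of_card_le
  · intro x hx
    obtain ⟨a, ha, rfl⟩ := Finset.mem_image.1 hx
    rw [ordIdx_eq n I hk (Finset.mem_range.1 ha)]
    exact Finset.orderEmbOfFin_mem _ _ _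
  · rw [card_pset n I hk, Finset.card_image_of_injOn (ordIdx_injOn n I hk), Finset.card_range]

theorem prod_ordIdx (n : ℕ) (I : Equiv.Perm (Fin n)) {k : ℕ} (hk : k ≤ n) (F : ℕ → ℂ) :
    ∏ a ∈ Finset.range k, F (ordIdx n I k a) = ∏ j ∈ Finset.range k, F (pval n I j) := by
  rw [← Finset.prod_image (f := F) (g := ordIdx n I k) (ordIdx_injOn n I hk),
    ← Finset.prod_image (f := F) (g := pval n I) (pval_injOn n I hk), image_ordIdx n I hk]

/-- A bijective enumeration dominating the sorted one is the sorted one. -/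
theorem eq_ordIdx_of_le (n : ℕ) (I : Equiv.Perm (Fin n)) {k : ℕ} (hk : k ≤ n) (f : ℕ → ℕ)
    (hinj : Set.InjOn f (Finset.range k : Set ℕ))
    (himg : (Finset.range k).image f = (Finset.range k).image (pval n I))
    (hle : ∀ a, a < k → ordIdx n I k a ≤ f a) : ∀ a, a < k → f a = ordIdx n I k a := by
  have hsum : ∑ a ∈ Finset.range k, ordIdx n I k a = ∑ a ∈ Finset.range k, f a := by
    have h1 := Finset.sum_image (f := fun x : ℕ => x) (g := ordIdx n I k) (ordIdx_injOn n I hk)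
    have h2 := Finset.sum_image (f := fun x : ℕ => x) (g := f) hinj
    rw [← h1, ← h2, himg, image_ordIdx n I hk]
  have := (Finset.sum_eq_sum_iff_of_le
    (fun a ha => hle a (Finset.mem_range.1 ha))).1 hsum
  intro a ha
  exact (this a (Finset.mem_range.2 ha)).symm

theorem ordIdx_top (n : ℕ) (I : Equiv.Perm (Fin n)) {a : ℕ} (ha : a < n) :
    ordIdx n I n a = a := by
  have himg : (Finset.range n).image (fun x : ℕ => x) = (Finset.range n).image (pval n I) := by
    symm
    rw [Finset.image_id']
    apply Finset.eq_of_subset_of_card_le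
    · intro x hx
      obtain ⟨a, ha, rfl⟩ := Finset.mem_image.1 hx
      exact Finset.mem_range.2 (pval_lt n I a (Finset.mem_range.1 ha))
    · rw [card_pset n I le_rfl, Finset.card_range]
  have hsum : ∀ b, b < n → b ≤ ordIdx n I n b := by
    intro b
    induction b with
    | zero => intro _; exact Nat.zero_le _
    | succ b ih =>
      intro hb
      have h1 := ih (by omega)
      have h2 := (ordIdx_lt_iff n I le_rfl (show b < n by omega) hb).2 (by omega)
      omega
  have hs : ∑ a ∈ Finset.range n, a = ∑ a ∈ Finset.range n, ordIdx n I n a := by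
    have h1 := Finset.sum_image (f := fun x : ℕ => x) (g := ordIdx n I n)
      (ordIdx_injOn n I le_rfl)
    rw [← h1, image_ordIdx n I le_rfl, ← himg, Finset.image_id']
  have := (Finset.sum_eq_sum_iff_of_le
    (fun a ha => hsum a (Finset.mem_range.1 ha))).1 hs
  exact (this a (Finset.mem_range.2 ha)).symm

theorem pval_jIdx (n : ℕ) (I : Equiv.Perm (Fin n)) {k a : ℕ} (hk : k ≤ n) (ha : a < k) :
    jIdx n I k a < k ∧ pval n I (jIdx n I k a) = ordIdx n I k a := by
  have hmem : ordIdx n I k a ∈ (Finset.range k).image (pval n I) := by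
    rw [← image_ordIdx n I hk]
    exact Finset.mem_image_of_mem _ (Finset.mem_range.2 ha)
  obtain ⟨j, hj, hja⟩ := Finset.mem_image.1 hmem
  have hjk := Finset.mem_range.1 hj
  have hjn : j < n := by omega
  have hlt : ordIdx n I k a < n := hja ▸ pval_lt n I j hjn
  have : jIdx n I k a = j := by
    unfold jIdx
    rw [dif_pos hlt]
    have : (⟨ordIdx n I k a, hlt⟩ : Fin n) = I ⟨j, hjn⟩ := by
      apply Fin.ext
      simp [← hja, pval, hjn]
    rw [this, Equiv.symm_apply_apply]
  rw [this]
  exact ⟨hjk, hja⟩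

/-- The index of the `u`-variable assigned to `t^{(k)}_a` by the tuple `π`. -/
def TIdx (n : ℕ) (I : Equiv.Perm (Fin n)) (π : (k : Fin n) → Equiv.Perm (Fin (k : ℕ)))
    (k a : ℕ) : ℕ :=
  if hk : k < n then (if ha : a < k then pval n I ((π ⟨k, hk⟩) ⟨a, ha⟩ : Fin k)
    else pval n I a) else a

theorem tvF_eq (n : ℕ) (I : Equiv.Perm (Fin n)) (π : (k : Fin n) → Equiv.Perm (Fin (k : ℕ)))
    (su : ℕ → ℂ) {k a : ℕ} (hk : k ≤ n) :
    tvF n (fun i => (su i)⁻¹) (permSt n π (fun _ a => (su (pval n I a))⁻¹)) k a =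
      (su (TIdx n I π k a))⁻¹ := by
  unfold tvF permSt TIdx
  rcases hk.eq_or_lt with rfl | hk
  · simp
  · rw [if_neg hk.ne]
    simp only [hk, dif_pos]
    split_ifs <;> rfl

theorem TIdx_spec (n : ℕ) (I : Equiv.Perm (Fin n)) (π : (k : Fin n) → Equiv.Perm (Fin (k : ℕ)))
    {k : ℕ} (hk : k < n) :
    Set.InjOn (TIdx n I π k) (Finset.range k : Set ℕ) ∧
      (Finset.range k).image (TIdx n I π k) = (Finset.range k).image (pval n I) := by
  have hinj : Set.InjOn (TIdx n I π k) (Finset.range k : Set ℕ) := by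
    intro a ha b hb h
    simp only [Finset.coe_range, Set.mem_Iio] at ha hb
    simp only [TIdx, hk, ha, hb, dif_pos] at h
    have h1 := pval_inj n I ((Fin.is_lt _).trans hk) ((Fin.is_lt _).trans hk) h
    have h2 := (π ⟨k, hk⟩).injective (Fin.ext h1)
    simpa using h2
  refine ⟨hinj, ?_⟩
  apply Finset.eq_of_subset_of_card_le
  · intro x hx
    obtain ⟨a, ha, rfl⟩ := Finset.mem_image.1 hx
    have ha := Finset.mem_range.1 ha
    simp only [TIdx, hk, ha, dif_pos]
    exact Finset.mem_image_of_mem _ (Finset.mem_range.2 (Fin.is_lt _))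
  · rw [card_pset n I hk.le, Finset.card_image_of_injOn hinj, Finset.card_range]

/-- The only term of the symmetrization that survives is the sorted one. -/
theorem TIdx_of_UF_ne_zero (n : ℕ) (I : Equiv.Perm (Fin n))
    (π : (k : Fin n) → Equiv.Perm (Fin (k : ℕ)))
    (q sh : ℂ) (su sμ : ℕ → ℂ) (hsu : ∀ i, i < n → su i ≠ 0)
    (hU : UF n I q sh sμ (fun i => (su i)⁻¹)
      (permSt n π (fun _ a => (su (pval n I a))⁻¹)) ≠ 0) :
    ∀ k, k ≤ n → ∀ a, a < k → TIdx n I π k a = ordIdx n I k a := by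
  have main : ∀ d k, k + d = n → ∀ a, a < k → TIdx n I π k a = ordIdx n I k a := by
    intro d
    induction d with
    | zero =>
      intro k hk a ha
      obtain rfl : k = n := by omega
      rw [ordIdx_top k I ha]
      simp [TIdx]
    | succ d ih =>
      intro k hk
      have hkn : k < n := by omega
      have IH := ih (k + 1) (by omega)
      obtain ⟨hinj, himg⟩ := TIdx_spec n I π hkn
      apply eq_ordIdx_of_le n I hkn.le _ hinj himg
      intro a ha
      by_contra hlt
      push Not at hlt
      apply hU
      have hmem : TIdx n I π k a ∈ (Finset.range (k + 1)).image (ordIdx n I (k + 1)) := by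
        rw [image_ordIdx n I hkn]
        have : TIdx n I π k a ∈ (Finset.range k).image (pval n I) := by
          rw [← himg]; exact Finset.mem_image_of_mem _ (Finset.mem_range.2 ha)
        exact Finset.image_subset_image (Finset.range_mono (Nat.le_succ k)) this
      obtain ⟨c, hc, hca⟩ := Finset.mem_image.1 hmem
      have hc' := Finset.mem_range.1 hc
      have hTn : TIdx n I π k a < n := by
        simp only [TIdx, hkn, ha, dif_pos]
        exact pval_lt n I _ ((Fin.is_lt _).trans hkn)
      unfold UF
      apply Finset.prod_eq_zero (Finset.mem_Icc.2 ⟨by omega, by omega⟩ : k ∈ _)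
      apply mul_eq_zero_of_left
      apply Finset.prod_eq_zero (Finset.mem_range.2 ha)
      apply Finset.prod_eq_zero hc
      rw [tvF_eq n I π su hkn, tvF_eq n I π su hkn.le, IH c hc', hca,
        div_self (inv_ne_zero (hsu _ hTn))]
      unfold psiF
      rw [if_pos (by omega), thetaH_one]
  intro k hk
  exact main (n - k) k (by omega)

/-- The factor `ψ` at the sorted point. -/
def PsiS (q sh : ℂ) (su : ℕ → ℂ) (s r : ℕ) : ℂ :=
  if r < s then thetaH q (su s / su r) else if r = s then 1 else thetaH q (su s / su r / sh)

/-- The ratio factor at the sorted point. -/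
def RatS (q sh : ℂ) (su : ℕ → ℂ) (s r : ℕ) : ℂ :=
  if s < r then thetaH q (sh * su s / su r) / thetaH q (su s / su r) else 1

theorem prod_sym_lemma (A B : ℕ → ℕ → ℂ) (c : ℂ) (k : ℕ)
    (hA : ∀ i, i < k → A i i = 1) (hB : ∀ i, i < k → B i i = c)
    (hAB : ∀ i j, j < k → i < j → A i j * A j i = B i j * B j i) :
    (∏ i ∈ Finset.range k, ∏ j ∈ Finset.range k, A i j) * c ^ k =
      ∏ i ∈ Finset.range k, ∏ j ∈ Finset.range k, B i j := by
  induction k with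
  | zero => simp
  | succ k ih =>
    have IH := ih (fun i hi => hA i (by omega)) (fun i hi => hB i (by omega))
      (fun i j hj => hAB i j (by omega))
    have key : (∏ i ∈ Finset.range k, A i k) * ∏ j ∈ Finset.range k, A k j =
        (∏ i ∈ Finset.range k, B i k) * ∏ j ∈ Finset.range k, B k j := by
      rw [← Finset.prod_mul_distrib, ← Finset.prod_mul_distrib]
      exact Finset.prod_congr rfl
        (fun i hi => hAB i k (by omega) (Finset.mem_range.1 hi))
    simp only [Finset.prod_range_succ, Finset.prod_mul_distrib]
    rw [← IH, hA k (by omega), hB k (by omega), pow_succ]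
    linear_combination
      (∏ i ∈ Finset.range k, ∏ j ∈ Finset.range k, A i j) * c ^ k * c * key

/-- Value of the `k`-th level of `U_I` at the sorted point. -/
theorem level_eq (n : ℕ) (I : Equiv.Perm (Fin n)) (q sh : ℂ) (su sμ : ℕ → ℂ)
    (π : (k : Fin n) → Equiv.Perm (Fin (k : ℕ)))
    (hπ : ∀ k, k ≤ n → ∀ a, a < k → TIdx n I π k a = ordIdx n I k a)
    (hsu : ∀ i, i < n → su i ≠ 0)
    (hden1 : ∀ j k, j < n → k < n → j ≠ k →
      thetaH q (sh⁻¹ * sμ j / sμ k) ≠ 0 ∧ thetaH q (sμ j / sμ k) ≠ 0)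
    {k : ℕ} (hk : k < n) :
    ((∏ a ∈ Finset.range k, ∏ c ∈ Finset.range (k + 1),
        psiF n I q sh sμ k a c
          (tvF n (fun i => (su i)⁻¹) (permSt n π (fun _ a => (su (pval n I a))⁻¹)) (k + 1) c /
            tvF n (fun i => (su i)⁻¹) (permSt n π (fun _ a => (su (pval n I a))⁻¹)) k a)) *
      ∏ a ∈ Finset.range k, ∏ b ∈ Finset.Ioo a k,
        thetaH q (sh * tvF n (fun i => (su i)⁻¹)
            (permSt n π (fun _ a => (su (pval n I a))⁻¹)) k b /
            tvF n (fun i => (su i)⁻¹) (permSt n π (fun _ a => (su (pval n I a))⁻¹)) k a) /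
          thetaH q (tvF n (fun i => (su i)⁻¹)
            (permSt n π (fun _ a => (su (pval n I a))⁻¹)) k b /
            tvF n (fun i => (su i)⁻¹) (permSt n π (fun _ a => (su (pval n I a))⁻¹)) k a)) =
    (∏ i ∈ Finset.range k, ∏ j ∈ Finset.range k,
        (PsiS q sh su (pval n I i) (pval n I j) * RatS q sh su (pval n I i) (pval n I j))) *
      ∏ i ∈ Finset.range k, PsiS q sh su (pval n I i) (pval n I k) := by
  have hon : ∀ m, m ≤ n → ∀ a, a < m → su (ordIdx n I m a) ≠ 0 := by
    intro m hm a ha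
    have h := pval_jIdx n I hm ha
    rw [← h.2]
    exact hsu _ (pval_lt n I _ (by omega))
  have h1 : (∏ a ∈ Finset.range k, ∏ c ∈ Finset.range (k + 1),
        psiF n I q sh sμ k a c
          (tvF n (fun i => (su i)⁻¹) (permSt n π (fun _ a => (su (pval n I a))⁻¹)) (k + 1) c /
            tvF n (fun i => (su i)⁻¹) (permSt n π (fun _ a => (su (pval n I a))⁻¹)) k a)) =
      ∏ i ∈ Finset.range k, ∏ j ∈ Finset.range (k + 1),
        PsiS q sh su (pval n I i) (pval n I j) := by
    rw [← prod_ordIdx n I hk.le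
      (fun s => ∏ j ∈ Finset.range (k + 1), PsiS q sh su s (pval n I j))]
    refine Finset.prod_congr rfl (fun a ha => ?_)
    have ha := Finset.mem_range.1 ha
    rw [← prod_ordIdx n I hk (fun r => PsiS q sh su (ordIdx n I k a) r)]
    refine Finset.prod_congr rfl (fun c hc => ?_)
    have hc := Finset.mem_range.1 hc
    rw [tvF_eq n I π su hk, tvF_eq n I π su hk.le, hπ (k + 1) hk c hc, hπ k hk.le a ha,
      inv_div_inv]
    unfold psiF PsiS
    split_ifs with h1 h2 h3 h3
    · rfl
    · rw [h2, div_self (hon k hk.le a ha), one_mul, div_self]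
      obtain ⟨hj, -⟩ := pval_jIdx n I hk.le ha
      exact (hden1 _ k (by omega) hk (by omega)).1
    · rw [h2, div_self (hon k hk.le a ha), one_mul, div_self]
      obtain ⟨hj, -⟩ := pval_jIdx n I hk.le ha
      rw [one_mul]
      exact (hden1 _ k (by omega) hk (by omega)).2
    · rfl
  have h2 : (∏ a ∈ Finset.range k, ∏ b ∈ Finset.Ioo a k,
        thetaH q (sh * tvF n (fun i => (su i)⁻¹)
            (permSt n π (fun _ a => (su (pval n I a))⁻¹)) k b /
            tvF n (fun i => (su i)⁻¹) (permSt n π (fun _ a => (su (pval n I a))⁻¹)) k a) /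
          thetaH q (tvF n (fun i => (su i)⁻¹)
            (permSt n π (fun _ a => (su (pval n I a))⁻¹)) k b /
            tvF n (fun i => (su i)⁻¹) (permSt n π (fun _ a => (su (pval n I a))⁻¹)) k a)) =
      ∏ i ∈ Finset.range k, ∏ j ∈ Finset.range k,
        RatS q sh su (pval n I i) (pval n I j) := by
    rw [← prod_ordIdx n I hk.le
      (fun s => ∏ j ∈ Finset.range k, RatS q sh su s (pval n I j))]
    refine Finset.prod_congr rfl (fun a ha => ?_)
    have ha := Finset.mem_range.1 ha
    rw [← prod_ordIdx n I hk.le (fun r => RatS q sh su (ordIdx n I k a) r)]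
    have hI : Finset.Ioo a k = (Finset.range k).filter (fun b => a < b) := by
      ext b; simp [and_comm]
    rw [hI, Finset.prod_filter]
    refine Finset.prod_congr rfl (fun b hb => ?_)
    have hb := Finset.mem_range.1 hb
    unfold RatS
    simp only [ordIdx_lt_iff n I hk.le ha hb]
    rw [tvF_eq n I π su hk.le, tvF_eq n I π su hk.le, hπ k hk.le a ha, hπ k hk.le b hb,
      inv_div_inv, mul_div_assoc, inv_div_inv, mul_div_assoc]
  rw [h1, h2]
  simp only [Finset.prod_range_succ, Finset.prod_mul_distrib]
  ring

theorem level_E (n : ℕ) (I : Equiv.Perm (Fin n)) (q sh : ℂ) (su : ℕ → ℂ)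
    (hsu : ∀ i, i < n → su i ≠ 0)
    (hden2 : ∀ i j, i < n → j < n → i ≠ j → thetaH q (su i / su j) ≠ 0)
    {k : ℕ} (hk : k < n) :
    (∏ i ∈ Finset.range k, ∏ j ∈ Finset.range k,
        (PsiS q sh su (pval n I i) (pval n I j) * RatS q sh su (pval n I i) (pval n I j))) *
      thetaH q sh ^ k =
    ∏ a ∈ Finset.range k, ∏ b ∈ Finset.range k,
      thetaH q (sh * tvF n (fun i => (su i)⁻¹) (fun _ a => (su (pval n I a))⁻¹) k b /
        tvF n (fun i => (su i)⁻¹) (fun _ a => (su (pval n I a))⁻¹) k a) := by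
  have two : ∀ s r, s < n → r < n → s < r →
      PsiS q sh su s r * RatS q sh su s r * (PsiS q sh su r s * RatS q sh su r s) =
        thetaH q (sh * (su r)⁻¹ / (su s)⁻¹) * thetaH q (sh * (su s)⁻¹ / (su r)⁻¹) := by
    intro s r hs hr hsr
    have e1 : sh * (su r)⁻¹ / (su s)⁻¹ = sh * su s / su r := by
      rw [mul_div_assoc, inv_div_inv, mul_div_assoc]
    have e2 : sh * (su s)⁻¹ / (su r)⁻¹ = (su s / su r / sh)⁻¹ := by
      rw [mul_div_assoc, inv_div_inv, inv_div, div_div_eq_mul_div, mul_div_assoc]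
    have e3 : su r / su s = (su s / su r)⁻¹ := by rw [inv_div]
    have hd := hden2 s r hs hr (by omega)
    unfold PsiS RatS
    rw [if_neg (by omega), if_neg (by omega), if_pos hsr, if_pos hsr, if_neg (by omega), e1, e2,
      e3, thetaH_inv, thetaH_inv]
    field_simp
  apply prod_sym_lemma
  · intro i hi
    simp [PsiS, RatS]
  · intro i hi
    have := hsu _ (pval_lt n I i (by omega))
    simp only [tvF, if_neg hk.ne]
    rw [mul_div_assoc, inv_div_inv, div_self this, mul_one]
  · intro i j hj hij
    simp only [tvF, if_neg hk.ne]
    have hne : pval n I i ≠ pval n I j := fun h =>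
      hij.ne (pval_inj n I (by omega) (by omega) h)
    rcases lt_or_gt_of_ne hne with h | h
    · exact two _ _ (pval_lt n I i (by omega)) (pval_lt n I j (by omega)) h
    · rw [mul_comm, two _ _ (pval_lt n I j (by omega)) (pval_lt n I i (by omega)) h, mul_comm]

theorem sign_eq_prod_range (n : ℕ) (I : Equiv.Perm (Fin n)) :
    ((Equiv.Perm.sign I : ℤ) : ℂ) =
      ∏ k ∈ Finset.range n, ∏ j ∈ Finset.range k,
        (if pval n I k < pval n I j then (-1 : ℂ) else 1) := by
  rw [Equiv.Perm.sign_eq_prod_prod_Iio, Finset.prod_range]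
  push_cast
  refine Finset.prod_congr rfl (fun k _ => ?_)
  symm
  refine Finset.prod_bij' (fun j hj => ⟨j, (Finset.mem_range.1 hj).trans k.2⟩) (fun j _ => j.val)
    ?_ ?_ ?_ ?_ ?_
  · intro j hj
    simpa [Fin.lt_def] using hj
  · intro j hj
    have hjk := Finset.mem_Iio.1 hj
    exact Finset.mem_range.2 hjk
  · intros; rfl
  · intros; rfl
  · intro j hj
    have hjk := Finset.mem_range.1 hj
    have hjn : j < n := hjk.trans k.2
    have hne : I ⟨j, hjn⟩ ≠ I k := by
      intro h
      have := I.injective h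
      have h2 : j = (k : ℕ) := congrArg Fin.val this
      omega
    have e1 : pval n I k = (I k : ℕ) := by
      unfold pval; rw [dif_pos k.2]
    have e2 : pval n I j = (I ⟨j, hjn⟩ : ℕ) := by
      unfold pval; rw [dif_pos hjn]
    rw [e1, e2]
    by_cases h : I ⟨j, hjn⟩ < I k
    · have h' : ¬ ((I k : ℕ) < (I ⟨j, hjn⟩ : ℕ)) := by rw [Fin.lt_def] at h; omega
      simp [h, h']
    · have h' : ((I k : ℕ) < (I ⟨j, hjn⟩ : ℕ)) := by
        have := lt_of_le_of_ne (not_lt.1 h) hne.symm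
        exact this
      simp [h, h']

theorem prod_pairsN (n : ℕ) (F : ℕ → ℕ → ℂ) :
    ∏ p ∈ pairsN n, F p.1 p.2 = ∏ k ∈ Finset.range n, ∏ j ∈ Finset.range k, F j k := by
  unfold pairsN
  rw [Finset.prod_filter, Finset.prod_product_right]
  refine Finset.prod_congr rfl (fun k hk => ?_)
  have hk := Finset.mem_range.1 hk
  rw [← Finset.prod_filter]
  refine Finset.prod_congr ?_ (fun _ _ => rfl)
  ext j
  simp only [Finset.mem_filter, Finset.mem_range]
  omega

theorem prod_Icc_eq_range (n : ℕ) (F : ℕ → ℂ) (h0 : F 0 = 1) (hn : 1 ≤ n) :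
    ∏ k ∈ Finset.Icc 1 (n - 1), F k = ∏ k ∈ Finset.range n, F k := by
  apply Finset.prod_subset
  · intro k hk
    simp only [Finset.mem_Icc] at hk
    simp only [Finset.mem_range]; omega
  · intro k hk hk'
    simp only [Finset.mem_Icc, Finset.mem_range] at hk hk'
    obtain rfl : k = 0 := by omega
    exact h0

/-- Lemma `stabd` of the paper: under the identification `t^{(k)}_a = 1/x^{(k)}_a`,
`w_i = 1/u_i`, `μ_j/μ_{j+1} = ħ z_j`, the normalized weight function `W̃_I = W_I/E`
evaluated at `x^{(k)}_j = u_{I_j}` equals `(−1)^{n(n−1)/2} sgn(I) Θ(N_I^+)`, where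
`Θ(N_I^+) = ∏_{j<k, I_k<I_j} ϑ(u_{I_k}/u_{I_j}) · ∏_{j<k, I_k>I_j} ϑ(ħ⁻¹ u_{I_j}/u_{I_k})`.
All parameters carry fixed square roots (`sq, sh, su i, sz i, sμ j` roots of
`q, ħ, u_{i+1}, z_{i+1}, μ_{j+1}`), and the parameters are generic so that `E` and every
theta denominator appearing is nonzero. -/
theorem weight_function_diagonal_stable_envelope
    (n : ℕ) (hn : 2 ≤ n) (I : Equiv.Perm (Fin n))
    (q sq h sh : ℂ) (su sz sμ : ℕ → ℂ)
    (hq0 : 0 < ‖q‖) (hq1 : ‖q‖ < 1)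
    (hsq : sq ^ 2 = q) (hsh : sh ^ 2 = h)
    (hμ : ∀ j, j < n - 1 → sμ j / sμ (j + 1) = sh * sz j)
    (hden1 : ∀ j k, j < n → k < n → j ≠ k →
      thetaH q (sh⁻¹ * sμ j / sμ k) ≠ 0 ∧ thetaH q (sμ j / sμ k) ≠ 0)
    (hden2 : ∀ i j, i < n → j < n → i ≠ j → thetaH q (su i / su j) ≠ 0)
    (hE : EF n q sh (fun i => (su i)⁻¹) (fun _ a => (su (pval n I a))⁻¹) ≠ 0) :
    WF n I q sh sμ (fun i => (su i)⁻¹) (fun _ a => (su (pval n I a))⁻¹) /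
        EF n q sh (fun i => (su i)⁻¹) (fun _ a => (su (pval n I a))⁻¹) =
      (-1) ^ (n * (n - 1) / 2) * ((Equiv.Perm.sign I : ℤ) : ℂ) *
        ∏ p ∈ pairsN n,
          (if pval n I p.2 < pval n I p.1 then
            thetaH q (su (pval n I p.2) / su (pval n I p.1))
          else thetaH q (sh⁻¹ * su (pval n I p.1) / su (pval n I p.2))) := by
  have hsu : ∀ i, i < n → su i ≠ 0 := by
    intro i hi h0
    obtain ⟨j, hj, hij⟩ : ∃ j, j < n ∧ i ≠ j := by
      by_cases h : i = 0
      · exact ⟨1, by omega, by omega⟩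
      · exact ⟨0, by omega, h⟩
    apply hden2 i j hi hj hij
    rw [h0, zero_div, thetaH_zero]
  -- the surviving term of the symmetrization
  have hex : ∃ π₀ : (k : Fin n) → Equiv.Perm (Fin (k : ℕ)),
      ∀ k, k ≤ n → ∀ a, a < k → TIdx n I π₀ k a = ordIdx n I k a := by
    have hbij : ∀ k : Fin n, Function.Bijective
        (fun a : Fin (k : ℕ) => (⟨jIdx n I k a, (pval_jIdx n I k.2.le a.2).1⟩ : Fin (k : ℕ))) := by
      intro k
      apply Finite.injective_iff_bijective.1
      intro a b hab
      simp only [Fin.mk.injEq] at hab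
      have h1 := (pval_jIdx n I k.2.le a.2).2
      have h2 := (pval_jIdx n I k.2.le b.2).2
      rw [hab, h2] at h1
      exact Fin.ext (ordIdx_injOn n I k.2.le (by simp) (by simp) h1.symm)
    refine ⟨fun k => Equiv.ofBijective _ (hbij k), ?_⟩
    intro k hk a ha
    rcases hk.eq_or_lt with rfl | hk
    · rw [ordIdx_top k I ha]
      simp [TIdx]
    · simp only [TIdx, hk, ha, dif_pos, Equiv.ofBijective_apply]
      exact (pval_jIdx n I hk.le ha).2
  obtain ⟨π₀, hπ₀⟩ := hex
  have huniq : ∀ π : (k : Fin n) → Equiv.Perm (Fin (k : ℕ)), π ≠ π₀ →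
      UF n I q sh sμ (fun i => (su i)⁻¹)
        (permSt n π (fun _ a => (su (pval n I a))⁻¹)) = 0 := by
    intro π hne
    by_contra hU
    apply hne
    have hπ := TIdx_of_UF_ne_zero n I π q sh su sμ hsu hU
    funext k
    ext a
    have h1 := hπ k k.2.le a a.2
    have h2 := hπ₀ k k.2.le a a.2
    rw [← h2] at h1
    simp only [TIdx, k.2, a.2, dif_pos, Fin.eta] at h1
    exact pval_inj n I ((Fin.is_lt _).trans k.2) ((Fin.is_lt _).trans k.2) h1
  have hW : WF n I q sh sμ (fun i => (su i)⁻¹) (fun _ a => (su (pval n I a))⁻¹) =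
      thetaH q sh⁻¹ ^ (n * (n - 1) / 2) *
        UF n I q sh sμ (fun i => (su i)⁻¹)
          (permSt n π₀ (fun _ a => (su (pval n I a))⁻¹)) := by
    unfold WF
    rw [Finset.sum_eq_single π₀ (fun π _ h => huniq π h) (fun h => absurd (Finset.mem_univ _) h)]
  have hUL : UF n I q sh sμ (fun i => (su i)⁻¹)
        (permSt n π₀ (fun _ a => (su (pval n I a))⁻¹)) * thetaH q sh ^ (n * (n - 1) / 2) =
      EF n q sh (fun i => (su i)⁻¹) (fun _ a => (su (pval n I a))⁻¹) *
        ∏ k ∈ Finset.range n, ∏ i ∈ Finset.range k,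
          PsiS q sh su (pval n I i) (pval n I k) := by
    have hpow : thetaH q sh ^ (n * (n - 1) / 2) =
        ∏ k ∈ Finset.Icc 1 (n - 1), thetaH q sh ^ k := by
      rw [prod_Icc_eq_range n _ (pow_zero _) (by omega), Finset.prod_pow_eq_pow_sum,
        Finset.sum_range_id]
    rw [hpow, ← prod_Icc_eq_range n _ (by simp) (by omega)]
    unfold UF EF
    rw [← Finset.prod_mul_distrib, ← Finset.prod_mul_distrib]
    refine Finset.prod_congr rfl (fun k hk => ?_)
    have hk := Finset.mem_Icc.1 hk
    rw [level_eq n I q sh su sμ π₀ hπ₀ hsu hden1 (show k < n by omega),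
      ← level_E n I q sh su hsu hden2 (show k < n by omega)]
    ring
  have hsgn : ∏ k ∈ Finset.range n, ∏ i ∈ Finset.range k,
          PsiS q sh su (pval n I i) (pval n I k) =
      ((Equiv.Perm.sign I : ℤ) : ℂ) *
        ∏ p ∈ pairsN n,
          (if pval n I p.2 < pval n I p.1 then
            thetaH q (su (pval n I p.2) / su (pval n I p.1))
          else thetaH q (sh⁻¹ * su (pval n I p.1) / su (pval n I p.2))) := by
    rw [prod_pairsN n (fun j k => if pval n I k < pval n I j then
            thetaH q (su (pval n I k) / su (pval n I j))
          else thetaH q (sh⁻¹ * su (pval n I j) / su (pval n I k))),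
      sign_eq_prod_range, ← Finset.prod_mul_distrib]
    refine Finset.prod_congr rfl (fun k hk => ?_)
    rw [← Finset.prod_mul_distrib]
    refine Finset.prod_congr rfl (fun j hj => ?_)
    have hk := Finset.mem_range.1 hk
    have hj := Finset.mem_range.1 hj
    have hne : pval n I k ≠ pval n I j := fun h =>
      hj.ne' (pval_inj n I (by omega) (by omega) h)
    unfold PsiS
    split_ifs with h1
    · rw [← inv_div, thetaH_inv]; ring
    · rw [one_mul]
      congr 1
      rw [div_eq_mul_inv _ sh]; ring
  have hth : thetaH q sh ≠ 0 := by
    intro h0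
    apply hE
    unfold EF
    have h1n : (1 : ℕ) ≠ n := by omega
    apply Finset.prod_eq_zero (Finset.mem_Icc.2 ⟨le_rfl, by omega⟩ : 1 ∈ _)
    have := hsu _ (pval_lt n I 0 (by omega))
    simp only [Finset.prod_range_one, tvF, if_neg h1n]
    rw [mul_div_assoc, inv_div_inv, div_self this, mul_one, h0]
  rw [hW, div_eq_iff hE, thetaH_inv, neg_pow, mul_assoc ((-1) ^ _) _ (∏ p ∈ pairsN n, _), ← hsgn]
  linear_combination (-1) ^ (n * (n - 1) / 2) * hUL
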